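/- arXiv:2203.05012 — 4 statements merged into one kernel-verified Lean document; each statement's English description precedes it below -/
import Mathlib

section
/- Let n ≥ 1, let A be an n×n real matrix, B ∈ ℝⁿ, and T > 0. Suppose (z¹,v¹),…,(z^{n+1},v^{n+1}) are solutions of ż = Az + Bv on [0,T] such that {zⁱ(0)}ᵢ₌₁^{n+1} is affinely independent, so the matrix Z(0) is invertible. Fix t₀ ≥ 0 and x₀ ∈ ℝⁿ, and set ζ = Z(0)⁻¹ x₀. Then the function z(t) = Z(t − t₀) ζ satisfies z(t₀) = x₀ and z′(t) = A z(t) + (V(t − t₀) ζ) • B for all t ∈ [t₀, t₀ + T], i.e., z is the solution of ż = Az + Bv under the input v(t) = V(t − t₀) ζ with initial condition z(t₀) = x₀. -/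
/-- The action of an `n × n` real matrix on `ℝⁿ` with the Euclidean norm. -/
noncomputable def matVec {n : ℕ} (M : Matrix (Fin n) (Fin n) ℝ)
    (x : EuclideanSpace ℝ (Fin n)) : EuclideanSpace ℝ (Fin n) :=
  Matrix.toEuclideanLin M x

/-- Given `n+1` points `w 0, …, w n` in `ℝⁿ`, the `n × n` matrix whose `i`-th column is
`w (i+1) - w 0`. -/
noncomputable def colDiffMat {n : ℕ} (w : Fin (n + 1) → EuclideanSpace ℝ (Fin n)) :
    Matrix (Fin n) (Fin n) ℝ :=
  Matrix.of fun r i => (w i.succ - w 0) r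

theorem matVec_colDiffMat {n : ℕ} (w : Fin (n + 1) → EuclideanSpace ℝ (Fin n))
    (x : EuclideanSpace ℝ (Fin n)) :
    matVec (colDiffMat w) x = ∑ j, x j • (w j.succ - w 0) := by
  ext r
  simp [matVec, colDiffMat, Matrix.mulVec, dotProduct, mul_comm]

theorem isUnit_colDiffMat {n : ℕ} {w : Fin (n + 1) → EuclideanSpace ℝ (Fin n)}
    (hw : AffineIndependent ℝ w) : IsUnit (colDiffMat w) := by
  rw [← Matrix.linearIndependent_cols_iff_isUnit]
  have h := ((affineIndependent_iff_linearIndependent_vsub ℝ w 0).1 hw).comp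
    (fun j : Fin n => ⟨j.succ, j.succ_ne_zero⟩) fun i j hij => by simpa using hij
  exact h.map' (WithLp.linearEquiv 2 ℝ (Fin n → ℝ)).toLinearMap (LinearEquiv.ker _)

theorem matVec_mul_inv_cancel {n : ℕ} {M : Matrix (Fin n) (Fin n) ℝ} (hM : IsUnit M)
    (x : EuclideanSpace ℝ (Fin n)) : matVec M (matVec M⁻¹ x) = x := by
  ext r
  simp [matVec, Matrix.mulVec_mulVec,
    Matrix.mul_nonsing_inv M ((Matrix.isUnit_iff_isUnit_det M).1 hM)]

/-- given `n+1` solutions of `ż = Az + Bv` on `[0,T]` whose initial states are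
affinely independent (so that `Z(0)` is invertible), for any `t₀ ≥ 0` and `x₀`, setting
`ζ = Z(0)⁻¹ x₀`, the function `z(t) = Z(t - t₀) ζ` satisfies `z(t₀) = x₀` and solves
`ż = Az + Bv` under the input `v(t) = V(t - t₀) ζ` on `[t₀, t₀ + T]`. -/
theorem learned_open_loop_solution
    (n : ℕ) (hn : 1 ≤ n)
    (A : Matrix (Fin n) (Fin n) ℝ) (B : EuclideanSpace ℝ (Fin n))
    (T : ℝ) (hT : 0 < T)
    (z : Fin (n + 1) → ℝ → EuclideanSpace ℝ (Fin n)) (v : Fin (n + 1) → ℝ → ℝ)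
    (hsol : ∀ i, ∀ t ∈ Set.Icc (0 : ℝ) T,
      HasDerivAt (z i) (matVec A (z i t) + v i t • B) t)
    (hindep : AffineIndependent ℝ (fun i => z i 0))
    (t₀ : ℝ) (ht₀ : 0 ≤ t₀) (x₀ : EuclideanSpace ℝ (Fin n))
    (ζ : EuclideanSpace ℝ (Fin n))
    (hζ : ζ = matVec (colDiffMat (fun i => z i 0))⁻¹ x₀) :
    matVec (colDiffMat (fun i => z i (t₀ - t₀))) ζ = x₀ ∧
      ∀ t ∈ Set.Icc t₀ (t₀ + T),
        HasDerivAt (fun s => matVec (colDiffMat (fun i => z i (s - t₀))) ζ)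
          (matVec A (matVec (colDiffMat (fun i => z i (t - t₀))) ζ) +
            (∑ j, (v j.succ (t - t₀) - v 0 (t - t₀)) * ζ j) • B) t := by
  refine ⟨?_, fun t ht => ?_⟩
  · rw [hζ, sub_self]
    exact matVec_mul_inv_cancel (isUnit_colDiffMat hindep) x₀
  · have hmem : t - t₀ ∈ Set.Icc (0 : ℝ) T := ⟨by linarith [ht.1], by linarith [ht.2]⟩
    have hz (i : Fin (n + 1)) := (hsol i _ hmem).comp_sub_const t t₀
    simp_rw [matVec_colDiffMat]
    refine (HasDerivAt.fun_sum (u := Finset.univ) fun (j : Fin n) _ =>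
      ((hz j.succ).fun_sub (hz 0)).fun_const_smul (ζ j)).congr_deriv ?_
    simp only [matVec, map_sum, map_smul, map_sub, Finset.sum_smul, ← Finset.sum_add_distrib]
    refine Finset.sum_congr rfl fun j _ => ?_
    module
end

section
/- Let n ≥ 1 and let β be a class 𝒦ℒ function. Let z¹,…,z^{n+1} : ℝ≥0 → ℝⁿ satisfy ‖zⁱ(t)‖ ≤ β(‖zⁱ(0)‖, t) for all t ≥ 0 and all i, and suppose {zⁱ(0)}ᵢ₌₁^{n+1} is affinely independent, so that Z(0) is invertible. Then there exists T̃ > 0 such that for every T ≥ T̃ the matrix Z(T) satisfies ‖Z(T) Z(0)⁻¹‖ < 1, where ‖·‖ is the operator 2-norm. -/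
/-- The operator norm of an `n × n` real matrix induced by the Euclidean vector norm
(the matrix 2-norm). -/
noncomputable def matOpNorm {n : ℕ} (M : Matrix (Fin n) (Fin n) ℝ) : ℝ :=
  ‖LinearMap.toContinuousLinearMap (Matrix.toEuclideanLin M)‖

/-- A class `𝒦ℒ` function `β : ℝ≥0 × ℝ≥0 → ℝ≥0` (modelled on `ℝ`, restricted to nonnegative
arguments): for each fixed `t ≥ 0`, `r ↦ β r t` is continuous, strictly increasing and vanishes
at `0` (class `𝒦`), and for each fixed `r ≥ 0`, `t ↦ β r t` is nonincreasing and tends to `0`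
as `t → ∞`. -/
structure IsKLFunction (β : ℝ → ℝ → ℝ) : Prop where
  nonneg : ∀ r t, 0 ≤ r → 0 ≤ t → 0 ≤ β r t
  continuousOn_fst : ∀ t, 0 ≤ t → ContinuousOn (fun r => β r t) (Set.Ici 0)
  strictMonoOn_fst : ∀ t, 0 ≤ t → StrictMonoOn (fun r => β r t) (Set.Ici 0)
  map_zero_fst : ∀ t, 0 ≤ t → β 0 t = 0
  antitoneOn_snd : ∀ r, 0 ≤ r → AntitoneOn (fun t => β r t) (Set.Ici 0)
  tendsto_snd : ∀ r, 0 ≤ r → Filter.Tendsto (fun t => β r t) Filter.atTop (nhds 0)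

open Filter Topology

theorem continuous_matOpNorm {n : ℕ} :
    Continuous (matOpNorm : Matrix (Fin n) (Fin n) ℝ → ℝ) :=
  (LinearMap.continuous_of_finiteDimensional
    ((Matrix.toEuclideanLin (𝕜 := ℝ) (m := Fin n) (n := Fin n)).trans
      LinearMap.toContinuousLinearMap).toLinearMap).norm

theorem continuous_colDiffMat {n : ℕ} :
    Continuous (colDiffMat : (Fin (n + 1) → EuclideanSpace ℝ (Fin n)) → _) := by
  refine continuous_matrix fun r i => ?_
  simp only [colDiffMat, Matrix.of_apply, PiLp.sub_apply]
  fun_prop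

theorem matOpNorm_zero {n : ℕ} : matOpNorm (0 : Matrix (Fin n) (Fin n) ℝ) = 0 := by
  simp [matOpNorm]

theorem colDiffMat_zero {n : ℕ} :
    colDiffMat (0 : Fin (n + 1) → EuclideanSpace ℝ (Fin n)) = 0 := by
  ext r i
  simp [colDiffMat]

theorem IsKLFunction.tendsto_zero_of_norm_le {E : Type*} [SeminormedAddCommGroup E]
    {β : ℝ → ℝ → ℝ} (hβ : IsKLFunction β) {x : ℝ → E}
    (hx : ∀ t ≥ (0 : ℝ), ‖x t‖ ≤ β ‖x 0‖ t) : Tendsto x atTop (𝓝 0) :=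
  squeeze_zero_norm' ((eventually_ge_atTop 0).mono hx) (hβ.tendsto_snd _ (norm_nonneg _))

/-- if the `n+1` demonstrations `zⁱ` satisfy a common class 𝒦ℒ bound and their
initial states are affinely independent (so `Z(0)` is invertible), then there is `T̃ > 0` such
that `‖Z(T) Z(0)⁻¹‖ < 1` for all `T ≥ T̃`. -/
theorem exists_time_monodromy_contracting
    (n : ℕ) (hn : 1 ≤ n)
    (β : ℝ → ℝ → ℝ) (hβ : IsKLFunction β)
    (z : Fin (n + 1) → ℝ → EuclideanSpace ℝ (Fin n))
    (hbound : ∀ i, ∀ t ≥ (0 : ℝ), ‖z i t‖ ≤ β ‖z i 0‖ t)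
    (hindep : AffineIndependent ℝ (fun i => z i 0)) :
    ∃ Ttil > (0 : ℝ), ∀ T ≥ Ttil,
      matOpNorm (colDiffMat (fun i => z i T) * (colDiffMat (fun i => z i 0))⁻¹) < 1 := by
  have hz : Tendsto (fun T i => z i T) atTop (𝓝 0) :=
    tendsto_pi_nhds.2 fun i => hβ.tendsto_zero_of_norm_le (hbound i)
  have hcont : Continuous fun w : Fin (n + 1) → EuclideanSpace ℝ (Fin n) =>
      matOpNorm (colDiffMat w * (colDiffMat fun i => z i 0)⁻¹) :=
    continuous_matOpNorm.comp (continuous_colDiffMat.matrix_mul continuous_const)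
  have hlim := (hcont.tendsto 0).comp hz
  rw [colDiffMat_zero, zero_mul, matOpNorm_zero] at hlim
  obtain ⟨T₀, hT₀⟩ := eventually_atTop.1 (hlim.eventually_lt_const one_pos)
  exact ⟨max T₀ 1, lt_max_of_lt_right one_pos, fun T hT => hT₀ T (le_of_max_le_left hT)⟩
end

section
/- Let n ≥ 1, M ≥ n+1, and let β be a class 𝒦ℒ function. Let z¹,…,z^M : ℝ≥0 → ℝⁿ satisfy ‖zⁱ(t)‖ ≤ β(‖zⁱ(0)‖, t) for all t ≥ 0 and all i. Let 𝓘₁,…,𝓘_P be finitely many index sets, each consisting of n+1 indices i₁ < ⋯ < i_{n+1} from {1,…,M}, such that for every j the set {z^{i}(0) : i ∈ 𝓘ⱼ} is affinely independent, so that each matrix Z_{𝓘ⱼ}(0) is invertible. Then there exists T̃ > 0 such that for every T ≥ T̃ and every j ∈ {1,…,P}, ‖Z_{𝓘ⱼ}(T) Z_{𝓘ⱼ}(0)⁻¹‖ < 1, where ‖·‖ is the operator 2-norm. -/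
open Filter Topology in
theorem tendsto_matOpNorm_zero {ι : Type*} {l : Filter ι} {n : ℕ}
    {A : ι → Matrix (Fin n) (Fin n) ℝ} (hA : Tendsto A l (𝓝 0)) :
    Tendsto (fun t => matOpNorm (A t)) l (𝓝 0) := by
  let f : Matrix (Fin n) (Fin n) ℝ →ₗ[ℝ]
      (EuclideanSpace ℝ (Fin n) →L[ℝ] EuclideanSpace ℝ (Fin n)) :=
    LinearMap.toContinuousLinearMap.toLinearMap ∘ₗ Matrix.toEuclideanLin.toLinearMap
  have hf : Continuous f := f.continuous_of_finiteDimensional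
  have h := (hf.norm.tendsto 0).comp hA
  rw [map_zero, norm_zero] at h
  exact h

open Filter Topology in
theorem tendsto_colDiffMat_zero {ι : Type*} {l : Filter ι} {n : ℕ}
    {w : Fin (n + 1) → ι → EuclideanSpace ℝ (Fin n)} (hw : ∀ k, Tendsto (w k) l (𝓝 0)) :
    Tendsto (fun t => colDiffMat fun k => w k t) l (𝓝 0) := by
  refine tendsto_pi_nhds.2 fun r => tendsto_pi_nhds.2 fun i => ?_
  have h := ((EuclideanSpace.proj (𝕜 := ℝ) r).continuous.tendsto 0).comp
    (by simpa using (hw i.succ).sub (hw 0))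
  rw [map_zero] at h
  exact h

/-- given `M ≥ n+1` demonstrations satisfying a common class 𝒦ℒ bound and
finitely many index sets `𝓘₁,…,𝓘_P` (each selecting `n+1` demonstrations, listed by a
strictly increasing map `Fin (n+1) → Fin M`) whose selected initial states are affinely
independent, there is a single `T̃ > 0` such that `‖Z_{𝓘ⱼ}(T) Z_{𝓘ⱼ}(0)⁻¹‖ < 1` for all
`T ≥ T̃` and all `j`. -/
theorem exists_time_all_monodromies_contracting
    (n M : ℕ) (hn : 1 ≤ n) (hM : n + 1 ≤ M)
    (β : ℝ → ℝ → ℝ) (hβ : IsKLFunction β)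
    (z : Fin M → ℝ → EuclideanSpace ℝ (Fin n))
    (hbound : ∀ i, ∀ t ≥ (0 : ℝ), ‖z i t‖ ≤ β ‖z i 0‖ t)
    (P : ℕ) (hP : 1 ≤ P)
    (𝓘 : Fin P → Fin (n + 1) → Fin M)
    (hmono : ∀ j, StrictMono (𝓘 j))
    (hindep : ∀ j, AffineIndependent ℝ (fun k => z (𝓘 j k) 0)) :
    ∃ Ttil > (0 : ℝ), ∀ T ≥ Ttil, ∀ j : Fin P,
      matOpNorm (colDiffMat (fun k => z (𝓘 j k) T) *
        (colDiffMat (fun k => z (𝓘 j k) 0))⁻¹) < 1 := by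
  have hz : ∀ i, Filter.Tendsto (z i) Filter.atTop (nhds 0) := fun i =>
    squeeze_zero_norm' ((Filter.eventually_ge_atTop 0).mono (hbound i))
      (hβ.tendsto_snd _ (norm_nonneg _))
  have hlt : ∀ j, ∀ᶠ T in Filter.atTop, matOpNorm (colDiffMat (fun k => z (𝓘 j k) T) *
      (colDiffMat (fun k => z (𝓘 j k) 0))⁻¹) < 1 := by
    intro j
    have hmul := (tendsto_colDiffMat_zero fun k => hz (𝓘 j k)).mul_const
      (colDiffMat (fun k => z (𝓘 j k) 0))⁻¹
    rw [zero_mul] at hmul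
    exact (tendsto_matOpNorm_zero hmul).eventually_lt_const one_pos
  obtain ⟨T₀, hT₀⟩ := Filter.eventually_atTop.1 (Filter.eventually_all.2 hlt)
  exact ⟨max T₀ 1, by positivity, fun T hT => hT₀ T (le_of_max_le_left hT)⟩
end

section
/- Let n ≥ 1, let A be an n×n real matrix and B ∈ ℝⁿ. Let (z¹,v¹),…,(z^{n+1},v^{n+1}) be solutions of ż = Az + Bv on ℝ≥0 with each zⁱ continuously differentiable, let β be a class 𝒦ℒ function with ‖zⁱ(t)‖ ≤ β(‖zⁱ(0)‖, t) for all t ≥ 0 and all i, and suppose {zⁱ(t)}ᵢ₌₁^{n+1} is affinely independent for every t ≥ 0, so that Z(t) is invertible for all t ≥ 0. Then there exists T̃ > 0 such that for every T ≥ T̃ the following holds: there exist M ≥ 1 and λ > 0 such that every continuous function z : ℝ≥0 → ℝⁿ that on each interval [pT,(p+1)T] (p ∈ ℕ) is differentiable and satisfies the closed-loop equation z′(t) = A z(t) + (V(t − pT) · Z(t − pT)⁻¹ · z(t)) • B, obeys ‖z(t)‖ ≤ M e^{−λ t} ‖z(0)‖ for all t ≥ 0. -/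
/-- A solution of the linear equation `y' = L' L⁻¹ y` is transported by `L`. -/
theorem eq_apply_inverse_apply_of_hasDerivWithinAt
    {E : Type*} [NormedAddCommGroup E] [NormedSpace ℝ E] [CompleteSpace E]
    {s : Set ℝ} (hs : Convex ℝ s) {L L' R : ℝ → E →L[ℝ] E} {y : ℝ → E}
    (hLR : ∀ t ∈ s, L t * R t = 1) (hRL : ∀ t ∈ s, R t * L t = 1)
    (hL : ∀ t ∈ s, HasDerivWithinAt L (L' t) s t)
    (hy : ∀ t ∈ s, HasDerivWithinAt y (L' t (R t (y t))) s t)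
    {a t : ℝ} (ha : a ∈ s) (ht : t ∈ s) :
    y t = L t (R a (y a)) := by
  have hinv : ∀ t ∈ s, Ring.inverse (L t) = R t := fun t ht =>
    Ring.inverse_unit (⟨L t, R t, hLR t ht, hRL t ht⟩ : (E →L[ℝ] E)ˣ)
  have hderiv : ∀ t ∈ s, HasDerivWithinAt (fun t => Ring.inverse (L t) (y t)) 0 s t := by
    intro t ht
    have h1 := (hasFDerivAt_ringInverse (𝕜 := ℝ)
      (⟨L t, R t, hLR t ht, hRL t ht⟩ : (E →L[ℝ] E)ˣ)).comp_hasDerivWithinAt t (hL t ht)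
    have h2 := h1.clm_apply (hy t ht)
    refine h2.congr_deriv ?_
    change -(R t (L' t (R t (y t)))) + Ring.inverse (L t) (L' t (R t (y t))) = 0
    rw [hinv t ht, neg_add_cancel]
  have hconst : Ring.inverse (L t) (y t) = Ring.inverse (L a) (y a) := by
    have h := hs.norm_image_sub_le_of_norm_hasDerivWithin_le (C := 0) hderiv
      (fun _ _ => by simp) ha ht
    simpa [sub_eq_zero] using h
  rw [hinv t ht, hinv a ha] at hconst
  rw [← hconst, ← mul_apply_eq_comp, hLR t ht, one_apply_eq_self]

/-- A function that is halved over each period of length `T`, and grows at most by a factor `K`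
within each period, decays exponentially. -/
theorem norm_le_exp_of_norm_le_half_period {E : Type*} [NormedAddCommGroup E]
    {w : ℝ → E} {T K : ℝ} (hT : 0 < T) (hK : 0 ≤ K)
    (hstep : ∀ p : ℕ, ‖w ((p + 1) * T)‖ ≤ 1 / 2 * ‖w (p * T)‖)
    (hper : ∀ p : ℕ, ∀ t ∈ Set.Icc ((p : ℝ) * T) ((p + 1) * T), ‖w t‖ ≤ K * ‖w (p * T)‖)
    {t : ℝ} (ht : 0 ≤ t) :
    ‖w t‖ ≤ 2 * K * Real.exp (-(Real.log 2 / T) * t) * ‖w 0‖ := by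
  have hp : ∀ p : ℕ, ‖w (p * T)‖ ≤ Real.exp (-(Real.log 2 * p)) * ‖w 0‖ := by
    intro p
    induction p with
    | zero => simp
    | succ p ih =>
      have he : Real.exp (-(Real.log 2 * (p + 1 : ℕ))) =
          1 / 2 * Real.exp (-(Real.log 2 * p)) := by
        rw [show -(Real.log 2 * (p + 1 : ℕ)) = -Real.log 2 + -(Real.log 2 * p) by
          push_cast; ring, Real.exp_add, Real.exp_neg, Real.exp_log two_pos]
        norm_num
      rw [he, mul_assoc]
      push_cast
      exact (hstep p).trans (by gcongr)
  set p := ⌊t / T⌋₊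
  have h1 : (p : ℝ) * T ≤ t := (le_div_iff₀ hT).1 (Nat.floor_le (by positivity))
  have h2 : t / T ≤ p + 1 := (Nat.lt_floor_add_one _).le
  have he : Real.exp (-(Real.log 2 * p)) ≤ 2 * Real.exp (-(Real.log 2 / T) * t) := by
    nth_rewrite 2 [← Real.exp_log two_pos]
    rw [← Real.exp_add, Real.exp_le_exp]
    have := mul_le_mul_of_nonneg_left h2 (Real.log_nonneg one_le_two)
    have : Real.log 2 / T * t = Real.log 2 * (t / T) := by ring
    linarith
  calc ‖w t‖ ≤ K * ‖w (p * T)‖ := hper p t ⟨h1, (div_le_iff₀ hT).1 h2⟩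
    _ ≤ K * (Real.exp (-(Real.log 2 * p)) * ‖w 0‖) := by gcongr; exact hp p
    _ ≤ K * (2 * Real.exp (-(Real.log 2 / T) * t) * ‖w 0‖) := by gcongr
    _ = _ := by ring

/-- The continuous linear map sending `c` to the linear combination `∑ j, c j • d j`. -/
noncomputable def linCombCLM {n : ℕ} {E : Type*} [NormedAddCommGroup E] [NormedSpace ℝ E]
    (d : Fin n → E) : EuclideanSpace ℝ (Fin n) →L[ℝ] E :=
  ∑ j, ContinuousLinearMap.smulRightL ℝ (EuclideanSpace ℝ (Fin n)) E
    (EuclideanSpace.proj j) (d j)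

theorem linCombCLM_apply {n : ℕ} {E : Type*} [NormedAddCommGroup E] [NormedSpace ℝ E]
    (d : Fin n → E) (c : EuclideanSpace ℝ (Fin n)) : linCombCLM d c = ∑ j, c j • d j := by
  simp [linCombCLM]

theorem continuous_linCombCLM {n : ℕ} {E : Type*} [NormedAddCommGroup E] [NormedSpace ℝ E] :
    Continuous (linCombCLM : (Fin n → E) → EuclideanSpace ℝ (Fin n) →L[ℝ] E) := by
  unfold linCombCLM
  fun_prop

theorem HasDerivAt.linCombCLM {n : ℕ} {E : Type*} [NormedAddCommGroup E] [NormedSpace ℝ E]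
    {d : ℝ → Fin n → E} {d' : Fin n → E} {t : ℝ}
    (hd : ∀ j, HasDerivAt (fun s => d s j) (d' j) t) :
    HasDerivAt (fun s => linCombCLM (d s)) (linCombCLM d') t :=
  HasDerivAt.fun_sum fun j _ =>
    (ContinuousLinearMap.smulRightL ℝ (EuclideanSpace ℝ (Fin n)) E
      (EuclideanSpace.proj j)).hasFDerivAt.comp_hasDerivAt t (hd j)

theorem toEuclideanCLM_colDiffMat {n : ℕ} (w : Fin (n + 1) → EuclideanSpace ℝ (Fin n)) :
    Matrix.toEuclideanCLM (𝕜 := ℝ) (colDiffMat w) = linCombCLM fun j => w j.succ - w 0 := by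
  ext c i
  simp [linCombCLM_apply, colDiffMat, Matrix.mulVec, dotProduct, mul_comm]

/-- paper's Theorem 1 in the feedback-linearized coordinates: given `n+1`
continuously differentiable expert solutions of `ż = Az + Bv` on `ℝ≥0` satisfying a common
class 𝒦ℒ bound, whose states are affinely independent at every time `t ≥ 0` (so `Z(t)` is
invertible), there is `T̃ > 0` such that for every sampling period `T ≥ T̃` there are
`M ≥ 1`, `λ > 0` such that every continuous trajectory of the closed loop under the learned
controller `v(t) = V(t − pT) Z(t − pT)⁻¹ z(t)` decays exponentially. -/
theorem learned_controller_uniform_exponential_stability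
    (n : ℕ) (hn : 1 ≤ n)
    (A : Matrix (Fin n) (Fin n) ℝ) (B : EuclideanSpace ℝ (Fin n))
    (z : Fin (n + 1) → ℝ → EuclideanSpace ℝ (Fin n)) (v : Fin (n + 1) → ℝ → ℝ)
    (hsol : ∀ i, ∀ t ≥ (0 : ℝ), HasDerivAt (z i) (matVec A (z i t) + v i t • B) t)
    (hC1 : ∀ i, ContDiffOn ℝ 1 (z i) (Set.Ici 0))
    (β : ℝ → ℝ → ℝ) (hβ : IsKLFunction β)
    (hbound : ∀ i, ∀ t ≥ (0 : ℝ), ‖z i t‖ ≤ β ‖z i 0‖ t)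
    (hindep : ∀ t ≥ (0 : ℝ), AffineIndependent ℝ (fun i => z i t)) :
    ∃ Ttil > (0 : ℝ), ∀ T ≥ Ttil,
      ∃ M ≥ (1 : ℝ), ∃ lam > (0 : ℝ),
        ∀ w : ℝ → EuclideanSpace ℝ (Fin n),
          ContinuousOn w (Set.Ici 0) →
          (∀ p : ℕ, ∀ t ∈ Set.Icc ((p : ℝ) * T) (((p : ℝ) + 1) * T),
            HasDerivWithinAt w
              (matVec A (w t) +
                (∑ j, (v j.succ (t - (p : ℝ) * T) - v 0 (t - (p : ℝ) * T)) *
                  matVec (colDiffMat (fun i => z i (t - (p : ℝ) * T)))⁻¹ (w t) j) • B)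
              (Set.Icc ((p : ℝ) * T) (((p : ℝ) + 1) * T)) t) →
          ∀ t ≥ (0 : ℝ), ‖w t‖ ≤ M * Real.exp (-lam * t) * ‖w 0‖ := by
  set L : ℝ → EuclideanSpace ℝ (Fin n) →L[ℝ] EuclideanSpace ℝ (Fin n) :=
    fun t => linCombCLM fun j => z j.succ t - z 0 t with hL_def
  set R : ℝ → EuclideanSpace ℝ (Fin n) →L[ℝ] EuclideanSpace ℝ (Fin n) :=
    fun t => Matrix.toEuclideanCLM (𝕜 := ℝ) (colDiffMat fun i => z i t)⁻¹ with hR_def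
  set L' : ℝ → EuclideanSpace ℝ (Fin n) →L[ℝ] EuclideanSpace ℝ (Fin n) := fun t =>
    linCombCLM fun j => (matVec A (z j.succ t) + v j.succ t • B) -
      (matVec A (z 0 t) + v 0 t • B) with hL'_def
  have hLR : ∀ t ≥ 0, L t * R t = 1 := fun t ht => by
    rw [hL_def, hR_def]
    simp only
    rw [← toEuclideanCLM_colDiffMat fun i => z i t, ← map_mul, Matrix.mul_nonsing_inv _
      ((Matrix.isUnit_iff_isUnit_det _).1 (isUnit_colDiffMat (hindep t ht))), map_one]
  have hRL : ∀ t ≥ 0, R t * L t = 1 := fun t ht => by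
    rw [hL_def, hR_def]
    simp only
    rw [← toEuclideanCLM_colDiffMat fun i => z i t, ← map_mul, Matrix.nonsing_inv_mul _
      ((Matrix.isUnit_iff_isUnit_det _).1 (isUnit_colDiffMat (hindep t ht))), map_one]
  have hL : ∀ t ≥ 0, HasDerivAt L (L' t) t := fun t ht =>
    HasDerivAt.linCombCLM fun j => (hsol j.succ t ht).sub (hsol 0 t ht)
  have hL' : ∀ t x, L' t x = matVec A (L t x) + (∑ j, (v j.succ t - v 0 t) * x j) • B := by
    intro t x
    simp only [hL'_def, hL_def, linCombCLM_apply, matVec, map_sum, map_smul, map_sub,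
      Finset.sum_smul, ← Finset.sum_add_distrib]
    refine Finset.sum_congr rfl fun j _ => ?_
    module
  have hz : ∀ i, Filter.Tendsto (z i) Filter.atTop (nhds 0) := fun i =>
    squeeze_zero_norm' ((Filter.eventually_ge_atTop 0).mono fun t ht => hbound i t ht)
      (hβ.tendsto_snd _ (norm_nonneg _))
  have hL0 : Filter.Tendsto L Filter.atTop (nhds 0) := by
    have h : Filter.Tendsto (fun t (j : Fin n) => z j.succ t - z 0 t) Filter.atTop (nhds 0) :=
      tendsto_pi_nhds.2 fun j => by simpa using (hz j.succ).sub (hz 0)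
    have h' := (continuous_linCombCLM.tendsto (0 : Fin n → EuclideanSpace ℝ (Fin n))).comp h
    rwa [show linCombCLM (0 : Fin n → EuclideanSpace ℝ (Fin n)) = 0 by
      ext; simp [linCombCLM_apply]] at h'
  have hLR0 : Filter.Tendsto (fun t => ‖L t * R 0‖) Filter.atTop (nhds 0) := by
    simpa using (hL0.mul_const (R 0)).norm
  obtain ⟨T₀, hT₀⟩ := Filter.eventually_atTop.1
    (hLR0.eventually_le_const (show (0 : ℝ) < 1 / 2 by norm_num))
  refine ⟨max T₀ 1, by positivity, fun T hT => ?_⟩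
  have hTpos : 0 < T := lt_of_lt_of_le (by positivity) hT
  obtain ⟨K, hK⟩ := isCompact_Icc.exists_bound_of_continuousOn (s := Set.Icc 0 T)
    (f := fun t => L t * R 0) fun t ht =>
      ((hL t ht.1).continuousAt.mul continuousAt_const).continuousWithinAt
  have hK1 : (1 : ℝ) ≤ max K 1 := le_max_right _ _
  refine ⟨2 * max K 1, by linarith, Real.log 2 / T,
    div_pos (Real.log_pos one_lt_two) hTpos, fun w _ hw t ht => ?_⟩
  have hflow : ∀ p : ℕ, ∀ t ∈ Set.Icc ((p : ℝ) * T) (((p : ℝ) + 1) * T),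
      w t = (L (t - p * T) * R 0) (w (p * T)) := by
    intro p t ht
    have h := eq_apply_inverse_apply_of_hasDerivWithinAt (convex_Icc ((p : ℝ) * T) ((p + 1) * T))
      (L := fun t => L (t - p * T)) (R := fun t => R (t - p * T))
      (L' := fun t => L' (t - p * T)) (y := w)
      (fun t ht => hLR _ (sub_nonneg.2 ht.1)) (fun t ht => hRL _ (sub_nonneg.2 ht.1))
      (fun t ht => ((hL _ (sub_nonneg.2 ht.1)).comp_sub_const t _).hasDerivWithinAt)
      (fun t ht => by
        refine (hw p t ht).congr_deriv ?_
        rw [hL', ← mul_apply_eq_comp, hLR _ (sub_nonneg.2 ht.1)]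
        rfl)
      (a := p * T) ⟨le_rfl, by nlinarith⟩ ht
    simpa using h
  refine norm_le_exp_of_norm_le_half_period hTpos (by linarith) (fun p => ?_)
    (fun p t ht => ?_) ht
  · rw [hflow p _ ⟨by nlinarith, le_rfl⟩, show ((p : ℝ) + 1) * T - p * T = T by ring]
    exact ContinuousLinearMap.le_of_opNorm_le _ (hT₀ T ((le_max_left _ _).trans hT)) _
  · rw [hflow p t ht]
    refine ContinuousLinearMap.le_of_opNorm_le _ ((hK _ ⟨?_, ?_⟩).trans (le_max_left _ _)) _
    · linarith [ht.1]
    · linarith [ht.2]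
end
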